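/- arXiv:1907.04617 — 3 statements merged into one kernel-verified Lean document; each statement's English description precedes it below -/
import Mathlib

section
/- Let n > 1 and let L be the second order cone in ℝ^n. A matrix A ∈ ℝ^{n×n} is a Z-transformation on L if and only if there exist a real number γ, a positive semidefinite symmetric matrix P ∈ ℝ^{n×n}, and a skew-symmetric matrix Q ∈ ℝ^{n×n} such that A = γ·I − J(P + Q), where J = diag(1,−1,…,−1). -/
open Matrix

noncomputable section

/-- The second order cone in `ℝⁿ`: `{(t,u) : t ≥ ‖u‖}` (first coordinate is `t`). -/
def soc (n : ℕ) [NeZero n] : Set (Fin n → ℝ) :=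
  {x | Real.sqrt (∑ i, if i = 0 then 0 else (x i) ^ 2) ≤ x 0}

/-- The boundary of the second order cone: `{(t,u) : t = ‖u‖}`. -/
def socBd (n : ℕ) [NeZero n] : Set (Fin n → ℝ) :=
  {x | Real.sqrt (∑ i, if i = 0 then 0 else (x i) ^ 2) = x 0}

/-- `J = diag(1, -1, …, -1)`. -/
def Jmat (n : ℕ) [NeZero n] : Matrix (Fin n) (Fin n) ℝ :=
  Matrix.diagonal (fun i => if i = 0 then 1 else -1)

/-- The dual cone of a set `K ⊆ ℝⁿ`. -/
def dualCone {n : ℕ} (K : Set (Fin n → ℝ)) : Set (Fin n → ℝ) :=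
  {y | ∀ x ∈ K, 0 ≤ x ⬝ᵥ y}

/-- `A` is a Z-transformation on `K`: `x ∈ K`, `y ∈ K*`, `⟨x,y⟩ = 0` imply `⟨Ax,y⟩ ≤ 0`. -/
def IsZTransf {n : ℕ} (K : Set (Fin n → ℝ)) (A : Matrix (Fin n) (Fin n) ℝ) : Prop :=
  ∀ x ∈ K, ∀ y ∈ dualCone K, x ⬝ᵥ y = 0 → (A.mulVec x) ⬝ᵥ y ≤ 0

/-- The completely positive cone of `C`: all finite sums `∑ uᵢuᵢᵀ` with `uᵢ ∈ C`. -/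
def cpCone {n : ℕ} (C : Set (Fin n → ℝ)) : Set (Matrix (Fin n) (Fin n) ℝ) :=
  {X | ∃ (m : ℕ) (u : Fin m → Fin n → ℝ), (∀ i, u i ∈ C) ∧ X = ∑ i, vecMulVec (u i) (u i)}

/-- The copositive cone of `C`: symmetric matrices `A` with `xᵀAx ≥ 0` for all `x ∈ C`. -/
def copCone {n : ℕ} (C : Set (Fin n → ℝ)) : Set (Matrix (Fin n) (Fin n) ℝ) :=
  {A | Aᵀ = A ∧ ∀ x ∈ C, 0 ≤ x ⬝ᵥ A.mulVec x}

/-- `Ω = {(x,y) ∈ L × L : ‖x‖ = 1 = ‖y‖, ⟨x,y⟩ = 0}`. -/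
def OmegaSet (n : ℕ) [NeZero n] : Set ((Fin n → ℝ) × (Fin n → ℝ)) :=
  {p | p.1 ∈ soc n ∧ p.2 ∈ soc n ∧ Real.sqrt (∑ i, p.1 i ^ 2) = 1 ∧
       Real.sqrt (∑ i, p.2 i ^ 2) = 1 ∧ p.1 ⬝ᵥ p.2 = 0}

/-- `γ(A) = max {⟨Ax,y⟩ : (x,y) ∈ Ω}`. -/
def gammaFun (n : ℕ) [NeZero n] (A : Matrix (Fin n) (Fin n) ℝ) : ℝ :=
  sSup {r | ∃ p ∈ OmegaSet n, r = (A.mulVec p.1) ⬝ᵥ p.2}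

/-- Finsler's lemma: a quadratic form that is nonnegative on the isotropic vectors of an indefinite
form `C` becomes nonnegative after adding a multiple of `C`. -/
theorem exists_nonneg_add_smul_of_nonneg_on_isotropic {ι : Type*} [Fintype ι]
    (B C : Matrix ι ι ℝ) (hpos : ∃ x, 0 < x ⬝ᵥ C *ᵥ x) (hneg : ∃ x, x ⬝ᵥ C *ᵥ x < 0)
    (h : ∀ x, x ⬝ᵥ C *ᵥ x = 0 → 0 ≤ x ⬝ᵥ B *ᵥ x) :
    ∃ γ : ℝ, ∀ x, 0 ≤ x ⬝ᵥ B *ᵥ x + γ * (x ⬝ᵥ C *ᵥ x) := by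
  have expand : ∀ (M : Matrix ι ι ℝ) (x z : ι → ℝ) (t : ℝ),
      (x + t • z) ⬝ᵥ M *ᵥ (x + t • z) =
        x ⬝ᵥ M *ᵥ x + t * (x ⬝ᵥ M *ᵥ z + z ⬝ᵥ M *ᵥ x) + t ^ 2 * (z ⬝ᵥ M *ᵥ z) := by
    intro M x z t
    simp only [mulVec_add, mulVec_smul, add_dotProduct, dotProduct_add, smul_dotProduct,
      dotProduct_smul, smul_eq_mul]
    ring
  have key : ∀ x z, 0 < x ⬝ᵥ C *ᵥ x → z ⬝ᵥ C *ᵥ z < 0 →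
      -(x ⬝ᵥ B *ᵥ x) / (x ⬝ᵥ C *ᵥ x) ≤ (z ⬝ᵥ B *ᵥ z) / -(z ⬝ᵥ C *ᵥ z) := by
    intro x z hx hz
    have hB := expand B x z
    have hC := expand C x z
    have hiso := fun t : ℝ => h (x + t • z)
    simp only [hB, hC] at hiso
    generalize x ⬝ᵥ C *ᵥ x = p at *
    generalize z ⬝ᵥ C *ᵥ z = m at *
    generalize x ⬝ᵥ C *ᵥ z + z ⬝ᵥ C *ᵥ x = b at *
    generalize x ⬝ᵥ B *ᵥ z + z ⬝ᵥ B *ᵥ x = c at *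
    generalize x ⬝ᵥ B *ᵥ x = a at *
    generalize z ⬝ᵥ B *ᵥ z = d at *
    have hD : b ^ 2 < b ^ 2 - 4 * p * m := by nlinarith
    obtain ⟨s, hs, hs2⟩ : ∃ s : ℝ, |b| < s ∧ s ^ 2 = b ^ 2 - 4 * p * m :=
      ⟨√(b ^ 2 - 4 * p * m), by rw [← Real.sqrt_sq_eq_abs]; exact Real.sqrt_lt_sqrt (sq_nonneg b) hD,
        Real.sq_sqrt ((sq_nonneg b).trans hD.le)⟩
    obtain ⟨hs₁, hs₂⟩ := abs_lt.1 hs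
    have hm : m ≠ 0 := hz.ne
    have h₁ := hiso ((-b - s) / (2 * m)) (by field_simp; linear_combination hs2)
    have h₂ := hiso ((-b + s) / (2 * m)) (by field_simp; linear_combination hs2)
    have hsum : 0 ≤ 2 * s * (4 * m * (m * a - p * d)) := by
      have e : 2 * s * (4 * m * (m * a - p * d)) = 4 * m ^ 2 *
          ((s - b) * (a + (-b - s) / (2 * m) * c + ((-b - s) / (2 * m)) ^ 2 * d) +
          (s + b) * (a + (-b + s) / (2 * m) * c + ((-b + s) / (2 * m)) ^ 2 * d)) := by
        field_simp
        linear_combination (-2 * s * d) * hs2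
      rw [e]
      have := mul_nonneg (sub_nonneg.2 hs₂.le) h₁
      have := mul_nonneg (show 0 ≤ s + b by linarith) h₂
      positivity
    have hs0 : 0 < 2 * s := by linarith
    have : m * a - p * d ≤ 0 := by
      have := nonneg_of_mul_nonneg_right hsum hs0
      nlinarith
    rw [div_le_div_iff₀ hx (neg_pos.2 hz)]
    linarith
  obtain ⟨x₀, hx₀⟩ := hpos
  obtain ⟨z₀, hz₀⟩ := hneg
  let S : Set ℝ := {r | ∃ x, 0 < x ⬝ᵥ C *ᵥ x ∧ r = -(x ⬝ᵥ B *ᵥ x) / (x ⬝ᵥ C *ᵥ x)}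
  refine ⟨sSup S, fun x => ?_⟩
  rcases lt_trichotomy (x ⬝ᵥ C *ᵥ x) 0 with hx | hx | hx
  · have : sSup S ≤ (x ⬝ᵥ B *ᵥ x) / -(x ⬝ᵥ C *ᵥ x) :=
      csSup_le ⟨_, x₀, hx₀, rfl⟩ (by rintro _ ⟨y, hy, rfl⟩; exact key y x hy hx)
    rw [le_div_iff₀ (neg_pos.2 hx)] at this
    linarith
  · simpa [hx] using h x hx
  · have : -(x ⬝ᵥ B *ᵥ x) / (x ⬝ᵥ C *ᵥ x) ≤ sSup S :=
      le_csSup ⟨_, by rintro _ ⟨y, hy, rfl⟩; exact key y z₀ hy hz₀⟩ ⟨x, hx, rfl⟩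
    rw [div_le_iff₀ hx] at this
    linarith

theorem mem_soc_iff {n : ℕ} [NeZero n] {x : Fin n → ℝ} :
    x ∈ soc n ↔ 0 ≤ x 0 ∧ ∑ i ∈ Finset.univ.erase 0, x i ^ 2 ≤ x 0 ^ 2 := by
  have : (∑ i, if i = 0 then 0 else x i ^ 2) = ∑ i ∈ Finset.univ.erase 0, x i ^ 2 := by
    rw [← Finset.add_sum_erase _ _ (Finset.mem_univ 0), if_pos rfl, zero_add]
    exact Finset.sum_congr rfl fun i hi => if_neg (Finset.ne_of_mem_erase hi)
  rw [soc, Set.mem_ofPred_eq, this, Real.sqrt_le_iff]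

theorem dotProduct_eq_add_sum_erase {n : ℕ} [NeZero n] (x y : Fin n → ℝ) :
    x ⬝ᵥ y = x 0 * y 0 + ∑ i ∈ Finset.univ.erase 0, x i * y i :=
  (Finset.add_sum_erase _ (fun i => x i * y i) (Finset.mem_univ 0)).symm

theorem Jmat_mulVec_zero {n : ℕ} [NeZero n] (x : Fin n → ℝ) : (Jmat n *ᵥ x) 0 = x 0 := by
  simp [Jmat, mulVec_diagonal]

theorem Jmat_mulVec_of_ne {n : ℕ} [NeZero n] (x : Fin n → ℝ) {i : Fin n} (hi : i ≠ 0) :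
    (Jmat n *ᵥ x) i = -x i := by
  simp [Jmat, mulVec_diagonal, hi]

theorem Jmat_mul_self (n : ℕ) [NeZero n] : Jmat n * Jmat n = 1 := by
  rw [Jmat, diagonal_mul_diagonal, ← diagonal_one]
  congr 1
  ext i
  split_ifs <;> norm_num

theorem Jmat_transpose (n : ℕ) [NeZero n] : (Jmat n)ᵀ = Jmat n := diagonal_transpose _

theorem Jmat_mulVec_dotProduct {n : ℕ} [NeZero n] (x y : Fin n → ℝ) :
    (Jmat n *ᵥ x) ⬝ᵥ y = x ⬝ᵥ Jmat n *ᵥ y := by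
  rw [dotProduct_mulVec, ← mulVec_transpose, Jmat_transpose]

theorem dotProduct_Jmat_mulVec {n : ℕ} [NeZero n] (x y : Fin n → ℝ) :
    x ⬝ᵥ Jmat n *ᵥ y = x 0 * y 0 - ∑ i ∈ Finset.univ.erase 0, x i * y i := by
  rw [dotProduct_eq_add_sum_erase, Jmat_mulVec_zero, sub_eq_add_neg, ← Finset.sum_neg_distrib]
  congr 1
  refine Finset.sum_congr rfl fun i hi => ?_
  rw [Jmat_mulVec_of_ne y (Finset.ne_of_mem_erase hi), mul_neg]

theorem Jmat_mulVec_mem_soc {n : ℕ} [NeZero n] {x : Fin n → ℝ} (hx : x ∈ soc n) :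
    Jmat n *ᵥ x ∈ soc n := by
  rw [mem_soc_iff] at hx ⊢
  rw [Jmat_mulVec_zero]
  refine ⟨hx.1, le_of_eq_of_le (Finset.sum_congr rfl fun i hi => ?_) hx.2⟩
  rw [Jmat_mulVec_of_ne x (Finset.ne_of_mem_erase hi), neg_sq]

theorem soc_subset_dualCone (n : ℕ) [NeZero n] : soc n ⊆ dualCone (soc n) := by
  intro y hy x hx
  rw [mem_soc_iff] at hx hy
  have h := Finset.sum_mul_sq_le_sq_mul_sq (Finset.univ.erase (0 : Fin n)) x y
  have hle : (∑ i ∈ Finset.univ.erase 0, x i * y i) ^ 2 ≤ (x 0 * y 0) ^ 2 := by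
    rw [mul_pow]
    exact h.trans (mul_le_mul hx.2 hy.2 (Finset.sum_nonneg fun i _ => sq_nonneg _) (sq_nonneg _))
  rw [dotProduct_eq_add_sum_erase]
  linarith [neg_le_of_abs_le (abs_le_of_sq_le_sq hle (mul_nonneg hx.1 hy.1))]

theorem dualCone_soc_subset (n : ℕ) [NeZero n] : dualCone (soc n) ⊆ soc n := by
  intro y hy
  have hS : 0 ≤ ∑ i ∈ Finset.univ.erase 0, y i ^ 2 := Finset.sum_nonneg fun i _ => sq_nonneg _
  set S := ∑ i ∈ Finset.univ.erase 0, y i ^ 2 with hSdef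
  have hy0 : 0 ≤ y 0 := by
    have h := hy (Pi.single 0 1) (mem_soc_iff.2 ⟨by simp, by
      rw [Finset.sum_eq_zero fun i hi => by simp [Finset.ne_of_mem_erase hi]]; positivity⟩)
    simpa using h
  refine mem_soc_iff.2 ⟨hy0, ?_⟩
  let w : Fin n → ℝ := fun i => if i = 0 then √S else -y i
  have hw0 : w 0 = √S := if_pos rfl
  have hwi : ∀ i ∈ Finset.univ.erase (0 : Fin n), w i = -y i := fun i hi =>
    if_neg (Finset.ne_of_mem_erase hi)
  have hw : w ∈ soc n := by
    rw [mem_soc_iff, hw0, Real.sq_sqrt hS]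
    refine ⟨Real.sqrt_nonneg _, le_of_eq (Finset.sum_congr rfl fun i hi => ?_)⟩
    rw [hwi i hi, neg_sq]
  have h := hy w hw
  have hsum : ∑ i ∈ Finset.univ.erase 0, w i * y i = -S := by
    rw [hSdef, ← Finset.sum_neg_distrib]
    refine Finset.sum_congr rfl fun i hi => ?_
    rw [hwi i hi]
    ring
  rw [dotProduct_eq_add_sum_erase, hw0, hsum] at h
  nlinarith [Real.sq_sqrt hS, Real.sqrt_nonneg S, sq_nonneg (y 0 - √S)]

theorem dualCone_soc (n : ℕ) [NeZero n] : dualCone (soc n) = soc n :=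
  (dualCone_soc_subset n).antisymm (soc_subset_dualCone n)

/-- Orthogonal elements of the second order cone are, up to scaling, reflections of each other. -/
theorem smul_eq_smul_Jmat_mulVec_of_dotProduct_eq_zero {n : ℕ} [NeZero n] {x y : Fin n → ℝ}
    (hx : x ∈ soc n) (hy : y ∈ soc n) (hxy : x ⬝ᵥ y = 0) :
    x 0 • y = y 0 • Jmat n *ᵥ x := by
  rw [mem_soc_iff] at hx hy
  rw [dotProduct_eq_add_sum_erase] at hxy
  have hexp : ∑ i ∈ Finset.univ.erase 0, (x 0 * y i + y 0 * x i) ^ 2 =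
      x 0 ^ 2 * ∑ i ∈ Finset.univ.erase 0, y i ^ 2 +
        2 * x 0 * y 0 * ∑ i ∈ Finset.univ.erase 0, x i * y i +
        y 0 ^ 2 * ∑ i ∈ Finset.univ.erase 0, x i ^ 2 := by
    simp only [Finset.mul_sum, ← Finset.sum_add_distrib]
    exact Finset.sum_congr rfl fun i _ => by ring
  have hzero : ∑ i ∈ Finset.univ.erase 0, (x 0 * y i + y 0 * x i) ^ 2 = 0 := by
    refine le_antisymm ?_ (Finset.sum_nonneg fun i _ => sq_nonneg _)
    rw [hexp, eq_neg_of_add_eq_zero_right hxy]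
    nlinarith [mul_le_mul_of_nonneg_left hy.2 (sq_nonneg (x 0)),
      mul_le_mul_of_nonneg_left hx.2 (sq_nonneg (y 0))]
  rw [Finset.sum_eq_zero_iff_of_nonneg fun i _ => sq_nonneg _] at hzero
  ext i
  rw [Pi.smul_apply, Pi.smul_apply, smul_eq_mul, smul_eq_mul]
  by_cases hi : i = 0
  · rw [hi, Jmat_mulVec_zero, mul_comm]
  · rw [Jmat_mulVec_of_ne x hi]
    linarith [pow_eq_zero_iff two_ne_zero |>.1 (hzero i (Finset.mem_erase.2 ⟨hi, Finset.mem_univ i⟩))]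

theorem eq_zero_of_mem_soc_of_apply_zero {n : ℕ} [NeZero n] {x : Fin n → ℝ} (hx : x ∈ soc n)
    (h0 : x 0 = 0) : x = 0 := by
  have h := (mem_soc_iff.1 hx).2
  rw [h0, zero_pow two_ne_zero] at h
  have hzero := le_antisymm h (Finset.sum_nonneg fun i _ => sq_nonneg (x i))
  rw [Finset.sum_eq_zero_iff_of_nonneg fun i _ => sq_nonneg _] at hzero
  ext i
  by_cases hi : i = 0
  · rw [hi, h0, Pi.zero_apply]
  · exact pow_eq_zero_iff two_ne_zero |>.1 (hzero i (Finset.mem_erase.2 ⟨hi, Finset.mem_univ i⟩))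

theorem dotProduct_mulVec_self_of_transpose_eq_neg {ι : Type*} [Fintype ι] {Q : Matrix ι ι ℝ}
    (hQ : Qᵀ = -Q) (x : ι → ℝ) : x ⬝ᵥ Q *ᵥ x = 0 := by
  have h : x ⬝ᵥ Q *ᵥ x = -(x ⬝ᵥ Q *ᵥ x) := by
    conv_lhs => rw [dotProduct_mulVec, ← mulVec_transpose, hQ, neg_mulVec, neg_dotProduct,
      dotProduct_comm]
  linarith

theorem IsZTransf.dotProduct_mulVec_nonpos {n : ℕ} [NeZero n] {A : Matrix (Fin n) (Fin n) ℝ}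
    (hA : IsZTransf (soc n) A) {x : Fin n → ℝ} (hx : x ⬝ᵥ Jmat n *ᵥ x = 0) :
    x ⬝ᵥ (Jmat n * A) *ᵥ x ≤ 0 := by
  have of_nonneg : ∀ x : Fin n → ℝ, x ⬝ᵥ Jmat n *ᵥ x = 0 → 0 ≤ x 0 →
      x ⬝ᵥ (Jmat n * A) *ᵥ x ≤ 0 := by
    intro x hx h0
    have hmem : x ∈ soc n := by
      refine mem_soc_iff.2 ⟨h0, ?_⟩
      rw [dotProduct_Jmat_mulVec] at hx
      simp only [sq]
      linarith
    have h := hA x hmem _ (soc_subset_dualCone n (Jmat_mulVec_mem_soc hmem)) hx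
    rwa [← Jmat_mulVec_dotProduct, dotProduct_comm, mulVec_mulVec] at h
  rcases le_total 0 (x 0) with h0 | h0
  · exact of_nonneg x hx h0
  · have h := of_nonneg (-x) (by simpa [mulVec_neg] using hx) (by simpa using h0)
    simpa [mulVec_neg] using h

theorem stmt0 (n : ℕ) [NeZero n] (hn : 1 < n) (A : Matrix (Fin n) (Fin n) ℝ) :
    IsZTransf (soc n) A ↔
      ∃ (γ : ℝ) (P Q : Matrix (Fin n) (Fin n) ℝ), P.PosSemidef ∧ Qᵀ = -Q ∧
        A = γ • (1 : Matrix (Fin n) (Fin n) ℝ) - Jmat n * (P + Q) := by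
  constructor
  · intro hA
    have hne : (⟨1, hn⟩ : Fin n) ≠ 0 := by simp [Fin.ext_iff]
    obtain ⟨γ, hγ⟩ := exists_nonneg_add_smul_of_nonneg_on_isotropic (-(Jmat n * A)) (Jmat n)
      ⟨Pi.single 0 1, by simp [Jmat]⟩
      ⟨Pi.single ⟨1, hn⟩ 1, by simp [Jmat, hne]⟩
      (fun x hx => by
        rw [neg_mulVec, dotProduct_neg]
        exact neg_nonneg.2 (hA.dotProduct_mulVec_nonpos hx))
    refine ⟨γ, γ • Jmat n - (1 / 2 : ℝ) • (Jmat n * A + (Jmat n * A)ᵀ),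
      (1 / 2 : ℝ) • ((Jmat n * A)ᵀ - Jmat n * A), ?_, ?_, ?_⟩
    · refine PosSemidef.of_dotProduct_mulVec_nonneg ?_ fun x => ?_
      · rw [IsHermitian, conjTranspose_eq_transpose_of_trivial, transpose_sub, transpose_smul,
          transpose_smul, transpose_add, transpose_transpose, Jmat_transpose, add_comm]
      · have ht : x ⬝ᵥ (Jmat n * A)ᵀ *ᵥ x = x ⬝ᵥ (Jmat n * A) *ᵥ x := by
          rw [mulVec_transpose, dotProduct_comm, ← dotProduct_mulVec]
        have := hγ x
        simp only [star_trivial, sub_mulVec, smul_mulVec, add_mulVec, neg_mulVec, dotProduct_neg,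
          dotProduct_sub, dotProduct_add, dotProduct_smul, smul_eq_mul, ht] at this ⊢
        linarith
    · rw [transpose_smul, transpose_sub, transpose_transpose, ← smul_neg, neg_sub]
    · have hPQ : γ • Jmat n - (1 / 2 : ℝ) • (Jmat n * A + (Jmat n * A)ᵀ) +
          (1 / 2 : ℝ) • ((Jmat n * A)ᵀ - Jmat n * A) = γ • Jmat n - Jmat n * A := by
        module
      rw [hPQ, mul_sub, mul_smul_comm, ← mul_assoc, Jmat_mul_self, one_mul, sub_sub_cancel]
  · rintro ⟨γ, P, Q, hP, hQ, rfl⟩ x hx y hy hxy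
    rw [dualCone_soc] at hy
    rcases (mem_soc_iff.1 hx).1.eq_or_lt with h0 | h0
    · rw [eq_zero_of_mem_soc_of_apply_zero hx h0.symm, mulVec_zero, zero_dotProduct]
    have hscale : x 0 * ((Jmat n * (P + Q)) *ᵥ x ⬝ᵥ y) = y 0 * (x ⬝ᵥ P *ᵥ x) := by
      rw [← smul_eq_mul, ← dotProduct_smul,
        smul_eq_smul_Jmat_mulVec_of_dotProduct_eq_zero hx hy hxy, dotProduct_smul, smul_eq_mul,
        ← Jmat_mulVec_dotProduct, mulVec_mulVec, ← mul_assoc, Jmat_mul_self, one_mul,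
        dotProduct_comm, add_mulVec, dotProduct_add,
        dotProduct_mulVec_self_of_transpose_eq_neg hQ, add_zero]
    have hPx : 0 ≤ x ⬝ᵥ P *ᵥ x := by simpa using hP.dotProduct_mulVec_nonneg x
    have hnonneg : 0 ≤ (Jmat n * (P + Q)) *ᵥ x ⬝ᵥ y :=
      nonneg_of_mul_nonneg_right (hscale ▸ mul_nonneg (mem_soc_iff.1 hy).1 hPx) h0
    rw [sub_mulVec, smul_mulVec, one_mulVec, sub_dotProduct, smul_dotProduct, hxy, smul_zero,
      zero_sub]
    exact neg_nonpos.2 hnonneg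
end
end

section
/- Let n > 1, let L be the second order cone in ℝ^n, and let J = diag(1,−1,…,−1). Then {X ∈ ℝ^{n×n} : tr(JX) = 0 and X is symmetric positive semidefinite} = {X ∈ ℝ^{n×n} : tr(JX) = 0 and X ∈ K_L}, where K_L is the set of finite sums Σᵢ uᵢuᵢᵀ with all uᵢ ∈ L. -/
open Matrix

noncomputable section

/-- If `f (x xᵀ)` and `f (y yᵀ)` have opposite signs, a plane rotation of `(x, y)` produces a pair
with the same sum of dyads whose first member is isotropic for `f`. -/
theorem exists_isotropic_rotation {ι : Type*} (f : Matrix ι ι ℝ →ₗ[ℝ] ℝ) (x y : ι → ℝ)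
    (h : f (vecMulVec y y) * f (vecMulVec x x) < 0) :
    ∃ u v : ι → ℝ, f (vecMulVec u u) = 0 ∧
      vecMulVec u u + vecMulVec v v = vecMulVec x x + vecMulVec y y := by
  set a := f (vecMulVec y y)
  set b := f (vecMulVec x y + vecMulVec y x)
  set c := f (vecMulVec x x)
  have ha : a ≠ 0 := by rintro h0; simp [h0] at h
  have hd : discrim a b c = √(discrim a b c) * √(discrim a b c) :=
    (Real.mul_self_sqrt (by unfold discrim; nlinarith [sq_nonneg b])).symm
  obtain ⟨t, ht⟩ := exists_quadratic_eq_zero ha ⟨_, hd⟩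
  have hpos : 0 < 1 + t ^ 2 := by positivity
  set r := (√(1 + t ^ 2))⁻¹
  have hr : r ^ 2 * (1 + t ^ 2) = 1 := by
    rw [inv_pow, Real.sq_sqrt hpos.le, inv_mul_cancel₀ hpos.ne']
  refine ⟨r • (x + t • y), r • (y - t • x), ?_, ?_⟩
  · have hu : vecMulVec (r • (x + t • y)) (r • (x + t • y)) =
        r ^ 2 • (vecMulVec x x + t • (vecMulVec x y + vecMulVec y x) +
          (t * t) • vecMulVec y y) := by
      ext i j
      simp [vecMulVec_apply]
      ring
    rw [hu]
    simp only [map_smul, smul_eq_mul, map_add f (_ + _), map_add f (vecMulVec x x)]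
    linear_combination r ^ 2 * ht
  · ext i j
    simp [vecMulVec_apply]
    linear_combination (x i * x j + y i * y j) * hr

/-- Sturm–Zhang rank-one decomposition: a sum of dyads annihilated by `f` is a sum of dyads each of
which is annihilated by `f`. -/
theorem sum_vecMulVec_mem_closure_isotropic {ι : Type*} (f : Matrix ι ι ℝ →ₗ[ℝ] ℝ)
    (s : Multiset (ι → ℝ)) (hs : (s.map fun x => f (vecMulVec x x)).sum = 0) :
    (s.map fun x => vecMulVec x x).sum ∈
      AddSubmonoid.closure {M | ∃ x, f (vecMulVec x x) = 0 ∧ M = vecMulVec x x} := by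
  induction hk : s.card generalizing s with
  | zero => simp [Multiset.card_eq_zero.mp hk]
  | succ k ih =>
    by_cases hall : ∀ x ∈ s, f (vecMulVec x x) = 0
    · refine AddSubmonoid.multiset_sum_mem _ _ fun M hM => ?_
      obtain ⟨x, hx, rfl⟩ := Multiset.mem_map.mp hM
      exact AddSubmonoid.subset_closure ⟨x, hall x hx, rfl⟩
    push Not at hall
    obtain ⟨x, hx, hx0⟩ := hall
    obtain ⟨r, rfl⟩ := Multiset.exists_cons_of_mem hx
    obtain ⟨y, hy, hxy⟩ : ∃ y ∈ r, f (vecMulVec y y) * f (vecMulVec x x) < 0 := by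
      by_contra! hcon
      have hnonneg : 0 ≤ (r.map fun y => f (vecMulVec y y) * f (vecMulVec x x)).sum :=
        Multiset.sum_nonneg fun z hz => by
          obtain ⟨y, hy, rfl⟩ := Multiset.mem_map.mp hz
          exact hcon y hy
      rw [Multiset.sum_map_mul_right] at hnonneg
      rw [Multiset.map_cons, Multiset.sum_cons] at hs
      rw [eq_neg_of_add_eq_zero_right hs] at hnonneg
      nlinarith [sq_pos_of_ne_zero hx0]
    obtain ⟨r, rfl⟩ := Multiset.exists_cons_of_mem hy
    obtain ⟨u, v, hu, huv⟩ := exists_isotropic_rotation f x y hxy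
    have hf := congrArg f huv
    simp only [map_add, hu] at hf
    simp only [Multiset.map_cons, Multiset.sum_cons, Multiset.card_cons] at hs hk ⊢
    rw [← add_assoc, ← huv, add_assoc]
    refine add_mem (AddSubmonoid.subset_closure ⟨u, hu, rfl⟩) ?_
    simpa using ih (v ::ₘ r) (by simp; linarith) (by simp; omega)

theorem vecMulVec_mem_cpCone {n : ℕ} {C : Set (Fin n → ℝ)} {x : Fin n → ℝ} (hx : x ∈ C) :
    vecMulVec x x ∈ cpCone C :=
  ⟨1, fun _ => x, fun _ => hx, by simp⟩

theorem closure_le_cpCone {n : ℕ} {C : Set (Fin n → ℝ)} {S : Set (Matrix (Fin n) (Fin n) ℝ)}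
    (hS : S ⊆ cpCone C) {X : Matrix (Fin n) (Fin n) ℝ} (hX : X ∈ AddSubmonoid.closure S) :
    X ∈ cpCone C := by
  induction hX using AddSubmonoid.closure_induction with
  | mem M hM => exact hS hM
  | zero => exact ⟨0, Fin.elim0, fun i => i.elim0, by simp⟩
  | add M N _ _ hM hN =>
    obtain ⟨k, u, hu, rfl⟩ := hM
    obtain ⟨l, v, hv, rfl⟩ := hN
    refine ⟨k + l, Fin.append u v, fun i => ?_, by simp [Fin.sum_univ_add]⟩
    induction i using Fin.addCases <;> simp [hu, hv]

theorem posSemidef_of_mem_cpCone {n : ℕ} {C : Set (Fin n → ℝ)} {X : Matrix (Fin n) (Fin n) ℝ}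
    (hX : X ∈ cpCone C) : X.PosSemidef := by
  obtain ⟨m, u, -, rfl⟩ := hX
  exact posSemidef_sum _ fun i _ => by simpa using posSemidef_vecMulVec_self_star (u i)

theorem trace_Jmat_mul_vecMulVec {n : ℕ} [NeZero n] (x : Fin n → ℝ) :
    (Jmat n * vecMulVec x x).trace = x 0 ^ 2 - ∑ i, if i = 0 then 0 else x i ^ 2 := by
  have h0 : x 0 ^ 2 = ∑ i, if i = 0 then x i ^ 2 else 0 := by simp
  rw [h0, ← Finset.sum_sub_distrib, Jmat, trace]
  refine Finset.sum_congr rfl fun i _ => ?_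
  rw [diag_apply, diagonal_mul, vecMulVec_apply]
  split_ifs <;> ring

theorem vecMulVec_mem_cpCone_soc {n : ℕ} [NeZero n] {x : Fin n → ℝ}
    (hx : (Jmat n * vecMulVec x x).trace = 0) : vecMulVec x x ∈ cpCone (soc n) := by
  rw [trace_Jmat_mul_vecMulVec, sub_eq_zero] at hx
  rcases le_total 0 (x 0) with h | h
  · refine vecMulVec_mem_cpCone ?_
    simp only [soc, Set.mem_ofPred_eq, ← hx, Real.sqrt_sq h, le_refl]
  · have hneg : -x ∈ soc n := by
      simp only [soc, Set.mem_ofPred_eq, Pi.neg_apply, neg_sq, ← hx, Real.sqrt_sq_eq_abs,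
        abs_of_nonpos h, le_refl]
    simpa using vecMulVec_mem_cpCone hneg

theorem stmt5 (n : ℕ) [NeZero n] (hn : 1 < n) :
    {X : Matrix (Fin n) (Fin n) ℝ | (Jmat n * X).trace = 0 ∧ X.PosSemidef} =
      {X : Matrix (Fin n) (Fin n) ℝ | (Jmat n * X).trace = 0 ∧ X ∈ cpCone (soc n)} := by
  ext X
  refine and_congr_right fun htr => ⟨fun hX => ?_, posSemidef_of_mem_cpCone⟩
  obtain ⟨m, v, rfl⟩ := posSemidef_iff_eq_sum_vecMulVec.mp hX
  let f : Matrix (Fin n) (Fin n) ℝ →ₗ[ℝ] ℝ :=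
    traceLinearMap (Fin n) ℝ ℝ ∘ₗ LinearMap.mulLeft ℝ (Jmat n)
  have hmem := sum_vecMulVec_mem_closure_isotropic f (Finset.univ.val.map v)
  simp only [Multiset.map_map, Function.comp_def, ← map_sum, Finset.sum_map_val] at hmem
  refine closure_le_cpCone ?_ (hmem htr)
  rintro _ ⟨x, hx, rfl⟩
  exact vecMulVec_mem_cpCone_soc hx
end
end

section
/- Let n > 1 and let L be the second order cone in ℝ^n. The interior of the cone Z(L) of Z-transformations on L (as a subset of ℝ^{n×n}) equals the set of strict Z-transformations on L, i.e., A lies in the interior of Z(L) if and only if ⟨Ax,y⟩ < 0 for all nonzero x, y ∈ L with ⟨x,y⟩ = 0. -/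
open Matrix

noncomputable section

theorem isClosed_dualCone {n : ℕ} (K : Set (Fin n → ℝ)) : IsClosed (dualCone K) := by
  have h : dualCone K = ⋂ x ∈ K, {y | 0 ≤ x ⬝ᵥ y} := by
    ext y
    simp [dualCone]
  rw [h]
  exact isClosed_biInter fun x _ => isClosed_le continuous_const (by fun_prop)

theorem smul_mem_dualCone {n : ℕ} {K : Set (Fin n → ℝ)} {c : ℝ} (hc : 0 ≤ c)
    {y : Fin n → ℝ} (hy : y ∈ dualCone K) : c • y ∈ dualCone K := fun x hx => by
  rw [dotProduct_smul, smul_eq_mul]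
  exact mul_nonneg hc (hy x hx)

theorem zero_le_apply_zero_of_mem_soc {n : ℕ} [NeZero n] {x : Fin n → ℝ} (hx : x ∈ soc n) :
    0 ≤ x 0 :=
  (Real.sqrt_nonneg _).trans hx

theorem mulVec_dotProduct_neg_of_mem_interior {n : ℕ} {K : Set (Fin n → ℝ)}
    {A : Matrix (Fin n) (Fin n) ℝ} (hA : A ∈ interior {B | IsZTransf K B})
    {x y : Fin n → ℝ} (hx : x ∈ K) (hy : y ∈ dualCone K) (hx0 : x ≠ 0) (hy0 : y ≠ 0)
    (hxy : x ⬝ᵥ y = 0) : A.mulVec x ⬝ᵥ y < 0 := by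
  have hcont : Continuous fun ε : ℝ => A + ε • vecMulVec y x := by fun_prop
  have hev : ∀ᶠ ε in nhds (0 : ℝ), A + ε • vecMulVec y x ∈ interior {B | IsZTransf K B} :=
    hcont.continuousAt.eventually_mem (isOpen_interior.mem_nhds (by simpa using hA))
  obtain ⟨ε, hε, hpos⟩ :=
    ((hev.filter_mono nhdsWithin_le_nhds).and (self_mem_nhdsWithin (s := Set.Ioi 0))).exists
  have h : (A + ε • vecMulVec y x).mulVec x ⬝ᵥ y ≤ 0 := interior_subset hε x hx y hy hxy
  have hsplit : (A + ε • vecMulVec y x).mulVec x ⬝ᵥ y =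
      A.mulVec x ⬝ᵥ y + ε * ((x ⬝ᵥ x) * (y ⬝ᵥ y)) := by
    simp [add_mulVec, smul_mulVec, vecMulVec_mulVec]
  have hxx : 0 < x ⬝ᵥ x := by
    simpa using dotProduct_star_self_pos_iff.2 hx0
  have hyy : 0 < y ⬝ᵥ y := by
    simpa using dotProduct_star_self_pos_iff.2 hy0
  have := mul_pos (Set.mem_Ioi.1 hpos) (mul_pos hxx hyy)
  linarith

theorem mem_interior_isZTransf_of_strict {n : ℕ} {K : Set (Fin n → ℝ)} (hK : dualCone K = K)
    {A : Matrix (Fin n) (Fin n) ℝ}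
    (hA : ∀ x ∈ K, ∀ y ∈ K, x ≠ 0 → y ≠ 0 → x ⬝ᵥ y = 0 → A.mulVec x ⬝ᵥ y < 0) :
    A ∈ interior {B | IsZTransf K B} := by
  have hclosed : IsClosed K := hK ▸ isClosed_dualCone K
  let S : Set (Fin n → ℝ) := Metric.sphere 0 1 ∩ K
  let T : Set ((Fin n → ℝ) × (Fin n → ℝ)) := S ×ˢ S ∩ {p | p.1 ⬝ᵥ p.2 = 0}
  have hS : IsCompact S := (isCompact_sphere 0 1).inter_right hclosed
  have hT : IsCompact T :=
    (hS.prod hS).inter_right (isClosed_eq (by fun_prop) continuous_const)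
  have hunit {x : Fin n → ℝ} (hx : x ∈ K) (hx0 : x ≠ 0) : ‖x‖⁻¹ • x ∈ S := by
    refine ⟨by simp [norm_smul, hx0], ?_⟩
    rw [← hK] at hx ⊢
    exact smul_mem_dualCone (by positivity) hx
  have hev : ∀ᶠ B in nhds A, ∀ p ∈ T, B.mulVec p.1 ⬝ᵥ p.2 < 0 := by
    refine hT.eventually_forall_of_forall_eventually fun p hp => ?_
    have hcont : Continuous fun q : Matrix (Fin n) (Fin n) ℝ × ((Fin n → ℝ) × (Fin n → ℝ)) =>
        q.1.mulVec q.2.1 ⬝ᵥ q.2.2 := by fun_prop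
    refine hcont.continuousAt.eventually_lt_const ?_
    exact hA _ hp.1.1.2 _ hp.1.2.2 (ne_zero_of_mem_unit_sphere ⟨_, hp.1.1.1⟩)
      (ne_zero_of_mem_unit_sphere ⟨_, hp.1.2.1⟩) hp.2
  rw [mem_interior_iff_mem_nhds]
  filter_upwards [hev] with B hB x hx y hy hxy
  rw [hK] at hy
  by_cases hx0 : x = 0
  · simp [hx0]
  by_cases hy0 : y = 0
  · simp [hy0]
  have h := hB (‖x‖⁻¹ • x, ‖y‖⁻¹ • y) ⟨⟨hunit hx hx0, hunit hy hy0⟩, by simp [hxy]⟩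
  simp only [mulVec_smul, smul_dotProduct, dotProduct_smul, smul_eq_mul] at h
  have hxp : 0 < ‖x‖⁻¹ := by positivity
  have hyp : 0 < ‖y‖⁻¹ := by positivity
  exact (neg_of_mul_neg_right (neg_of_mul_neg_right h hyp.le) hxp.le).le

theorem stmt11 (n : ℕ) [NeZero n] (hn : 1 < n) (A : Matrix (Fin n) (Fin n) ℝ) :
    A ∈ interior {B : Matrix (Fin n) (Fin n) ℝ | IsZTransf (soc n) B} ↔
      ∀ x ∈ soc n, ∀ y ∈ soc n, x ≠ 0 → y ≠ 0 → x ⬝ᵥ y = 0 → (A.mulVec x) ⬝ᵥ y < 0 :=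
  ⟨fun hA _ hx _ hy => mulVec_dotProduct_neg_of_mem_interior hA hx (soc_subset_dualCone n hy),
    mem_interior_isZTransf_of_strict (dualCone_soc n)⟩
end
end
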